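/- Let (X_i)_{i≥1} be identically distributed nonnegative random variables such that X₁ is regularly varying with index α > 0 and the family is uniformly asymptotically independent. Let (a_{i,j})_{i,j≥1} be a doubly indexed family of nonnegative random variables independent of (X_i), and let N be a positive integer-valued random variable, independent of (X_i) and of (a_{i,j}), with E[N^{2+α+ε}] < ∞ for some ε > 0. Let ‖·‖ be a norm on the space of finitely supported real sequences satisfying sup_i |u_i| ≤ ‖u‖ ≤ ∑_i |u_i|; for each n let A(n) = (a_{i,j})_{1≤i,j≤n}, with ‖A(n)‖ the operator norm induced by ‖·‖ on ℝⁿ, and assume E[‖A(N)‖^{α+ε} N^{1+α+ε}] < ∞ for some ε > 0. Then lim_{n₀→∞} sup_{x>0} ∑_{n>n₀} P(N=n) · P(‖A(n)·(X₁,…,X_n)‖ > x) / P(X₁ > x) = 0. -/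

import Mathlib

open MeasureTheory ProbabilityTheory Filter

/-- The product of the `n × n` upper-left corner of the doubly indexed array `a` (indexed from `1`)
with the sequence `u` (`0`-based: coordinate `j - 1` of `u` is the `j`-th entry of the vector),
viewed as a finitely supported sequence: coordinate `i` (`0`-based) is
`∑_{j=1}^n a (i+1) j * u (j-1)` for `i + 1 ≤ n` and `0` otherwise. -/
noncomputable def matVecSeq (a : ℕ → ℕ → ℝ) (n : ℕ) (u : ℕ → ℝ) : ℕ → ℝ :=
  fun i => if i + 1 ≤ n then ∑ j ∈ Finset.Icc 1 n, a (i + 1) j * u (j - 1) else 0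

/-- The operator norm of `u ↦ A(n) u` induced by the sequence norm `nn`, the supremum being taken
over sequences supported on the first `n` coordinates with `nn u ≤ 1`. -/
noncomputable def seqOpNorm (nn : (ℕ → ℝ) → ℝ) (a : ℕ → ℕ → ℝ) (n : ℕ) : ℝ :=
  ⨆ u : {u : ℕ → ℝ // nn u ≤ 1 ∧ ∀ i, n ≤ i → u i = 0},
    nn (matVecSeq a n (u : ℕ → ℝ))

theorem mv_supp (a : ℕ → ℕ → ℝ) (n : ℕ) (u : ℕ → ℝ) :
    (Function.support (matVecSeq a n u)).Finite := by
  apply (Finset.range n).finite_toSet.subset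
  intro i hi
  by_contra h
  apply hi
  have : ¬ (i + 1 ≤ n) := by simpa using h
  simp [matVecSeq, this]

theorem supp_fin (n : ℕ) (u : ℕ → ℝ) (h : ∀ i, n ≤ i → u i = 0) :
    (Function.support u).Finite := by
  apply (Finset.range n).finite_toSet.subset
  intro i hi
  by_contra h'
  apply hi
  exact h i (by simpa using h')

theorem nn_le_sum (nn : (ℕ → ℝ) → ℝ)
    (hnn_upper : ∀ u : ℕ → ℝ, (Function.support u).Finite → nn u ≤ ∑' i, |u i|)
    (n : ℕ) (u : ℕ → ℝ) (h : ∀ i, n ≤ i → u i = 0) :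
    nn u ≤ ∑ i ∈ Finset.range n, |u i| := by
  refine (hnn_upper u (supp_fin n u h)).trans ?_
  rw [tsum_eq_sum (s := Finset.range n)]
  intro i hi
  rw [h i (by simpa using hi), abs_zero]

theorem mv_zero (a : ℕ → ℕ → ℝ) (n : ℕ) (u : ℕ → ℝ) :
    ∀ i, n ≤ i → matVecSeq a n u i = 0 := by
  intro i hi
  have : ¬ (i + 1 ≤ n) := by omega
  simp [matVecSeq, this]

theorem nn_mv_le (nn : (ℕ → ℝ) → ℝ)
    (hnn_lower : ∀ u : ℕ → ℝ, (Function.support u).Finite → ∀ i, |u i| ≤ nn u)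
    (hnn_upper : ∀ u : ℕ → ℝ, (Function.support u).Finite → nn u ≤ ∑' i, |u i|)
    (a : ℕ → ℕ → ℝ) (n : ℕ) (u : ℕ → ℝ) (hu : nn u ≤ 1) (h : ∀ i, n ≤ i → u i = 0) :
    nn (matVecSeq a n u) ≤
      ∑ i ∈ Finset.range n, ∑ j ∈ Finset.Icc 1 n, |a (i + 1) j| := by
  refine (nn_le_sum nn hnn_upper n _ (mv_zero a n u)).trans ?_
  apply Finset.sum_le_sum
  intro i hi
  have hi' : i + 1 ≤ n := by simpa using hi
  simp only [matVecSeq, hi', if_true]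
  refine (Finset.abs_sum_le_sum_abs _ _).trans ?_
  apply Finset.sum_le_sum
  intro j _
  rw [abs_mul]
  have : |u (j - 1)| ≤ 1 := (hnn_lower u (supp_fin n u h) _).trans hu
  nlinarith [abs_nonneg (a (i + 1) j)]

theorem nn_zero' (nn : (ℕ → ℝ) → ℝ)
    (hnn_smul : ∀ (c : ℝ) (u : ℕ → ℝ), (Function.support u).Finite →
      nn (c • u) = |c| * nn u) : nn 0 = 0 := by
  have := hnn_smul 0 0 (by simp)
  simpa using this

theorem op_bdd (nn : (ℕ → ℝ) → ℝ)
    (hnn_lower : ∀ u : ℕ → ℝ, (Function.support u).Finite → ∀ i, |u i| ≤ nn u)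
    (hnn_upper : ∀ u : ℕ → ℝ, (Function.support u).Finite → nn u ≤ ∑' i, |u i|)
    (a : ℕ → ℕ → ℝ) (n : ℕ) :
    BddAbove (Set.range fun u : {u : ℕ → ℝ // nn u ≤ 1 ∧ ∀ i, n ≤ i → u i = 0} =>
      nn (matVecSeq a n (u : ℕ → ℝ))) := by
  refine ⟨∑ i ∈ Finset.range n, ∑ j ∈ Finset.Icc 1 n, |a (i + 1) j|, ?_⟩
  rintro _ ⟨u, rfl⟩
  exact nn_mv_le nn hnn_lower hnn_upper a n u u.2.1 u.2.2

theorem op_nonneg (nn : (ℕ → ℝ) → ℝ)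
    (hnn_lower : ∀ u : ℕ → ℝ, (Function.support u).Finite → ∀ i, |u i| ≤ nn u)
    (a : ℕ → ℕ → ℝ) (n : ℕ) : 0 ≤ seqOpNorm nn a n :=
  Real.iSup_nonneg fun u => (abs_nonneg _).trans (hnn_lower _ (mv_supp a n u) 0)

theorem op_lip (nn : (ℕ → ℝ) → ℝ)
    (hnn_tri : ∀ u v : ℕ → ℝ, (Function.support u).Finite → (Function.support v).Finite →
      nn (u + v) ≤ nn u + nn v)
    (hnn_smul : ∀ (c : ℝ) (u : ℕ → ℝ), (Function.support u).Finite →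
      nn (c • u) = |c| * nn u)
    (hnn_lower : ∀ u : ℕ → ℝ, (Function.support u).Finite → ∀ i, |u i| ≤ nn u)
    (hnn_upper : ∀ u : ℕ → ℝ, (Function.support u).Finite → nn u ≤ ∑' i, |u i|)
    (a b : ℕ → ℕ → ℝ) (n : ℕ) :
    seqOpNorm nn a n ≤ seqOpNorm nn b n +
      ∑ i ∈ Finset.range n, ∑ j ∈ Finset.Icc 1 n, |a (i + 1) j - b (i + 1) j| := by
  have : Nonempty {u : ℕ → ℝ // nn u ≤ 1 ∧ ∀ i, n ≤ i → u i = 0} :=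
    ⟨⟨0, by rw [nn_zero' nn hnn_smul]; norm_num, fun _ _ => rfl⟩⟩
  apply ciSup_le
  intro u
  have e : matVecSeq a n u = matVecSeq b n u + matVecSeq (fun i j => a i j - b i j) n u := by
    funext i
    simp only [matVecSeq, Pi.add_apply]
    split_ifs
    · rw [← Finset.sum_add_distrib]
      apply Finset.sum_congr rfl
      intros; ring
    · simp
  rw [e]
  refine (hnn_tri _ _ (mv_supp _ _ _) (mv_supp _ _ _)).trans ?_
  apply add_le_add
  · exact le_ciSup (op_bdd nn hnn_lower hnn_upper b n) u
  · exact nn_mv_le nn hnn_lower hnn_upper (fun i j => a i j - b i j) n u u.2.1 u.2.2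

theorem op_meas (nn : (ℕ → ℝ) → ℝ)
    (hnn_tri : ∀ u v : ℕ → ℝ, (Function.support u).Finite → (Function.support v).Finite →
      nn (u + v) ≤ nn u + nn v)
    (hnn_smul : ∀ (c : ℝ) (u : ℕ → ℝ), (Function.support u).Finite →
      nn (c • u) = |c| * nn u)
    (hnn_lower : ∀ u : ℕ → ℝ, (Function.support u).Finite → ∀ i, |u i| ≤ nn u)
    (hnn_upper : ∀ u : ℕ → ℝ, (Function.support u).Finite → nn u ≤ ∑' i, |u i|)
    (n : ℕ) :
    Measurable fun A : ℕ × ℕ → ℝ => seqOpNorm nn (fun i j => A (i, j)) n := by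
  apply Continuous.measurable
  rw [continuous_iff_continuousAt]
  intro B
  rw [ContinuousAt, tendsto_iff_dist_tendsto_zero]
  have hc : Continuous fun A : ℕ × ℕ → ℝ =>
      ∑ i ∈ Finset.range n, ∑ j ∈ Finset.Icc 1 n, |A (i + 1, j) - B (i + 1, j)| := by
    fun_prop
  refine squeeze_zero (fun _ => dist_nonneg) (fun A => ?_)
    (g := fun A : ℕ × ℕ → ℝ =>
      ∑ i ∈ Finset.range n, ∑ j ∈ Finset.Icc 1 n, |A (i + 1, j) - B (i + 1, j)|) ?_
  · rw [Real.dist_eq, abs_sub_le_iff]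
    constructor
    · have := op_lip nn hnn_tri hnn_smul hnn_lower hnn_upper (fun i j => A (i, j))
        (fun i j => B (i, j)) n
      linarith
    · have := op_lip nn hnn_tri hnn_smul hnn_lower hnn_upper (fun i j => B (i, j))
        (fun i j => A (i, j)) n
      simp only [abs_sub_comm (B _) (A _)] at this
      linarith
  · have := hc.tendsto B
    simpa using this

theorem mv_le_op (nn : (ℕ → ℝ) → ℝ)
    (hnn_smul : ∀ (c : ℝ) (u : ℕ → ℝ), (Function.support u).Finite →
      nn (c • u) = |c| * nn u)
    (hnn_zero : ∀ u : ℕ → ℝ, (Function.support u).Finite → nn u = 0 → u = 0)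
    (hnn_lower : ∀ u : ℕ → ℝ, (Function.support u).Finite → ∀ i, |u i| ≤ nn u)
    (hnn_upper : ∀ u : ℕ → ℝ, (Function.support u).Finite → nn u ≤ ∑' i, |u i|)
    (a : ℕ → ℕ → ℝ) (n : ℕ) (u : ℕ → ℝ) (h : ∀ i, n ≤ i → u i = 0) :
    nn (matVecSeq a n u) ≤ seqOpNorm nn a n * nn u := by
  have hs := supp_fin n u h
  have h0 : 0 ≤ nn u := (abs_nonneg _).trans (hnn_lower u hs 0)
  rcases h0.eq_or_lt with h0 | h0
  · have : u = 0 := hnn_zero u hs h0.symm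
    subst this
    have : matVecSeq a n 0 = 0 := by
      funext i; simp [matVecSeq]
    rw [this, nn_zero' nn hnn_smul]; simp
  · have e : matVecSeq a n ((nn u)⁻¹ • u) = (nn u)⁻¹ • matVecSeq a n u := by
      funext i
      simp only [matVecSeq, Pi.smul_apply, smul_eq_mul]
      split_ifs
      · rw [Finset.mul_sum]
        apply Finset.sum_congr rfl
        intros; ring
      · simp
    have := le_ciSup (op_bdd nn hnn_lower hnn_upper a n)
      ⟨(nn u)⁻¹ • u, by rw [hnn_smul _ _ hs, abs_of_pos (inv_pos.2 h0), inv_mul_cancel₀ h0.ne'],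
        fun i hi => by simp [h i hi]⟩
    simp only [e] at this
    rw [hnn_smul _ _ (mv_supp _ _ _), abs_of_pos (inv_pos.2 h0)] at this
    rw [inv_mul_le_iff₀ h0] at this
    rw [mul_comm]; exact this

theorem mv_le_sum (nn : (ℕ → ℝ) → ℝ)
    (hnn_smul : ∀ (c : ℝ) (u : ℕ → ℝ), (Function.support u).Finite →
      nn (c • u) = |c| * nn u)
    (hnn_zero : ∀ u : ℕ → ℝ, (Function.support u).Finite → nn u = 0 → u = 0)
    (hnn_lower : ∀ u : ℕ → ℝ, (Function.support u).Finite → ∀ i, |u i| ≤ nn u)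
    (hnn_upper : ∀ u : ℕ → ℝ, (Function.support u).Finite → nn u ≤ ∑' i, |u i|)
    (a : ℕ → ℕ → ℝ) (n : ℕ) (u : ℕ → ℝ) :
    nn (matVecSeq a n u) ≤ seqOpNorm nn a n * ∑ i ∈ Finset.range n, |u i| := by
  have e : matVecSeq a n u = matVecSeq a n (fun i => if i < n then u i else 0) := by
    funext i
    simp only [matVecSeq]
    split_ifs
    · apply Finset.sum_congr rfl
      intro j hj
      rw [Finset.mem_Icc] at hj
      rw [if_pos (by omega)]
    · rfl
  have hz : ∀ i, n ≤ i → (fun i => if i < n then u i else 0) i = 0 := by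
    intro i hi
    simp [hi]
  rw [e]
  refine (mv_le_op nn hnn_smul hnn_zero hnn_lower hnn_upper a n _ hz).trans ?_
  apply mul_le_mul_of_nonneg_left _ (op_nonneg nn hnn_lower a n)
  refine (nn_le_sum nn hnn_upper n _ hz).trans (le_of_eq ?_)
  apply Finset.sum_congr rfl
  intro i hi
  rw [if_pos (by simpa using hi)]

/-- Potter-type bound. -/
theorem potter (T : ℝ → ℝ) (hT : Antitone T) (hT1 : ∀ x, T x ≤ 1)
    (hpos : ∀ x, 0 < x → 0 < T x) (α β : ℝ) (hβ0 : 0 < β) (hβ : α < β)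
    (hRV : Tendsto (fun x => T (2 * x) / T x) atTop (nhds ((2 : ℝ) ^ (-α)))) :
    ∃ C : ℝ, 0 < C ∧ ∀ x, 0 < x → ∀ c, 0 < c → T (x / c) ≤ C * (1 + c ^ β) * T x := by
  have hlt : (2 : ℝ) ^ (-β) < 2 ^ (-α) :=
    Real.rpow_lt_rpow_of_exponent_lt (by norm_num) (by linarith)
  obtain ⟨x₁, hx₁⟩ := eventually_atTop.1 (hRV.eventually (lt_mem_nhds hlt))
  set x₀ := max x₁ 1 with hx₀
  have hx0 : 0 < x₀ := lt_of_lt_of_le one_pos (le_max_right _ _)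
  have step : ∀ y, x₀ ≤ y → T y ≤ 2 ^ β * T (2 * y) := by
    intro y hy
    have h1 := hx₁ y ((le_max_left _ _).trans hy)
    rw [lt_div_iff₀ (hpos y (hx0.trans_le hy)), Real.rpow_neg (by norm_num),
      inv_mul_lt_iff₀ (by positivity)] at h1
    exact h1.le
  have iter : ∀ k : ℕ, ∀ y, x₀ ≤ y → T y ≤ (2 ^ β) ^ k * T (2 ^ k * y) := by
    intro k
    induction k with
    | zero => intro y _; simp
    | succ k ih =>
      intro y hy
      have h2 : x₀ ≤ 2 ^ k * y := by
        have : (1 : ℝ) ≤ 2 ^ k := one_le_pow₀ (by norm_num)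
        nlinarith
      calc T y ≤ (2 ^ β) ^ k * T (2 ^ k * y) := ih y hy
        _ ≤ (2 ^ β) ^ k * (2 ^ β * T (2 * (2 ^ k * y))) := by
          gcongr; exact step _ h2
        _ = _ := by rw [pow_succ, pow_succ]; ring_nf
  have iter' : ∀ k : ℕ, ∀ y, 0 < y → T y ≤ (T x₀)⁻¹ * (2 ^ β) ^ k * T (2 ^ k * y) := by
    intro k y hy
    have hm : x₀ ≤ max y x₀ := le_max_right _ _
    have h1 := iter k _ hm
    have h2 : T (2 ^ k * max y x₀) ≤ T (2 ^ k * y) := hT (by gcongr; exact le_max_left _ _)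
    have h3 : T x₀ * T y ≤ T (max y x₀) := by
      rcases le_total y x₀ with h | h
      · rw [max_eq_right h]
        nlinarith [hT1 y, hpos _ hx0]
      · rw [max_eq_left h]
        nlinarith [hT1 x₀, hpos _ hy]
    rw [mul_assoc, ← div_eq_inv_mul, le_div_iff₀ (hpos _ hx0), mul_comm]
    refine h3.trans (h1.trans ?_)
    gcongr
  have hTi : 1 ≤ (T x₀)⁻¹ := (one_le_inv₀ (hpos _ hx0)).2 (hT1 _)
  have h2b : (1 : ℝ) ≤ 2 ^ β := Real.one_le_rpow (by norm_num) hβ0.le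
  refine ⟨(T x₀)⁻¹ * 2 ^ β, by positivity, ?_⟩
  intro x hx c hc
  have hcb : 0 ≤ c ^ β := by positivity
  have hTx := hpos x hx
  have hge1 : 1 ≤ (T x₀)⁻¹ * 2 ^ β := by nlinarith
  rcases le_total c 1 with h | h
  · have : T (x / c) ≤ T x := hT (by rw [le_div_iff₀ hc]; nlinarith)
    have h5 : 1 ≤ (T x₀)⁻¹ * 2 ^ β * (1 + c ^ β) := by nlinarith
    nlinarith
  · obtain ⟨k, hk1, hk2⟩ := exists_nat_pow_near h (by norm_num : (1 : ℝ) < 2)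
    have h6 := iter' (k + 1) (x / 2 ^ (k + 1)) (by positivity)
    have h7 : T (x / c) ≤ T (x / 2 ^ (k + 1)) := hT (by gcongr)
    rw [mul_div_cancel₀ _ (by positivity)] at h6
    have h8 : ((2 : ℝ) ^ β) ^ (k + 1) ≤ 2 ^ β * c ^ β := by
      rw [← Real.rpow_natCast, ← Real.rpow_mul (by norm_num), mul_comm, Real.rpow_mul (by norm_num),
        Real.rpow_natCast, ← Real.mul_rpow (by norm_num) hc.le]
      apply Real.rpow_le_rpow (by positivity) _ hβ0.le
      rw [pow_succ]; linarith
    calc T (x / c) ≤ _ := h7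
      _ ≤ _ := h6
      _ ≤ (T x₀)⁻¹ * (2 ^ β * c ^ β) * T x := by gcongr
      _ ≤ (T x₀)⁻¹ * (2 ^ β * (1 + c ^ β)) * T x := by gcongr; linarith
      _ = _ := by ring

theorem tail_indep {Ω : Type*} [MeasurableSpace Ω] (P : Measure Ω) [IsProbabilityMeasure P]
    (c Y : Ω → ℝ) (hc : Measurable c) (hY : Measurable Y) (h0 : ∀ ω, 0 ≤ c ω)
    (hi : IndepFun c Y P) (x : ℝ) (f : ℝ → ENNReal)
    (hb : ∀ s : ℝ, 0 ≤ s → P {ω | x < s * Y ω} ≤ f s) :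
    P {ω | x < c ω * Y ω} ≤ ∫⁻ ω, f (c ω) ∂P := by
  have hm : MeasurableSet {p : ℝ × ℝ | x < p.1 * p.2} :=
    measurableSet_lt measurable_const (by fun_prop)
  have e : P {ω | x < c ω * Y ω} =
      (P.map fun ω => (c ω, Y ω)) {p : ℝ × ℝ | x < p.1 * p.2} := by
    rw [Measure.map_apply (hc.prodMk hY) hm]; rfl
  rw [e, (indepFun_iff_map_prod_eq_prod_map_map hc.aemeasurable hY.aemeasurable).1 hi,
    Measure.prod_apply hm, lintegral_map (measurable_measure_prodMk_left hm) hc]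
  apply lintegral_mono
  intro ω
  refine le_trans (le_of_eq ?_) (hb (c ω) (h0 ω))
  beta_reduce
  rw [Measure.map_apply hY (measurable_prodMk_left hm)]
  rfl

theorem scal_bound {Ω : Type*} [MeasurableSpace Ω] (P : Measure Ω) [IsProbabilityMeasure P]
    (X₁ Y : Ω → ℝ) (hid : IdentDistrib Y X₁ P P) (C β : ℝ) (hC : 0 < C)
    (x : ℝ) (hx : 0 < x)
    (hpot : ∀ c : ℝ, 0 < c → (P {ω | x / c < X₁ ω}).toReal ≤
      C * (1 + c ^ β) * (P {ω | x < X₁ ω}).toReal)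
    (s : ℝ) (hs : 0 ≤ s) :
    P {ω | x < s * Y ω} ≤ ENNReal.ofReal (C * (1 + s ^ β)) * P {ω | x < X₁ ω} := by
  rcases hs.eq_or_lt with hs | hs
  · have : {ω | x < s * Y ω} = ∅ := by
      ext ω; simp [← hs, hx.le]
    rw [this]; simp
  · have e : {ω | x < s * Y ω} = Y ⁻¹' Set.Ioi (x / s) := by
      ext ω
      simp only [Set.mem_ofPred_eq, Set.mem_preimage, Set.mem_Ioi]
      rw [div_lt_iff₀' hs]
    have e2 : X₁ ⁻¹' Set.Ioi (x / s) = {ω | x / s < X₁ ω} := by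
      ext ω
      simp only [Set.mem_ofPred_eq, Set.mem_preimage, Set.mem_Ioi]
    rw [e, hid.measure_mem_eq measurableSet_Ioi, e2]
    have h := ENNReal.ofReal_le_ofReal (hpot s hs)
    have hp : 0 ≤ C * (1 + s ^ β) := by positivity
    rwa [ENNReal.ofReal_mul hp, ENNReal.ofReal_toReal (measure_ne_top _ _),
      ENNReal.ofReal_toReal (measure_ne_top _ _)] at h

set_option maxHeartbeats 400000

/-- Uniform integrability over the random dimension: under the regular variation,
uniform asymptotic independence, independence and moment assumptions,
`lim_{n₀ → ∞} sup_{x > 0} ∑_{n > n₀} P(N = n) · P(nn (A(n)·(X 1, …, X n)) > x) / P(X 1 > x) = 0`. -/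
theorem random_size_uniform_integrability
    {Ω : Type*} [MeasurableSpace Ω] (P : Measure Ω) [IsProbabilityMeasure P]
    (X : ℕ → Ω → ℝ) (hXmeas : ∀ i, Measurable (X i))
    (hXnonneg : ∀ i ω, 0 ≤ X i ω)
    (hXid : ∀ i, 1 ≤ i → IdentDistrib (X i) (X 1) P P)
    (α : ℝ) (hα : 0 < α)
    (hRVpos : ∀ x : ℝ, 0 < x → 0 < P {ω | x < X 1 ω})
    (hRV : ∀ t : ℝ, 0 < t →
      Tendsto (fun x => (P {ω | t * x < X 1 ω}).toReal / (P {ω | x < X 1 ω}).toReal)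
        atTop (nhds (t ^ (-α))))
    (hUAI : ∀ ε : ℝ, 0 < ε → ∃ x₀ : ℝ, ∀ x ≥ x₀, ∀ i j : ℕ, 1 ≤ i → 1 ≤ j → i ≠ j →
      (P {ω | x < X i ω ∧ x < X j ω}).toReal ≤ ε * (P {ω | x < X 1 ω}).toReal)
    (a : ℕ → ℕ → Ω → ℝ) (hameas : ∀ i j, Measurable fun ω => a i j ω)
    (hanonneg : ∀ i j ω, 0 ≤ a i j ω)
    (haX_indep : IndepFun (fun ω => fun q : ℕ × ℕ => a q.1 q.2 ω)
      (fun ω => fun i : ℕ => X i ω) P)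
    (N : Ω → ℕ) (hNmeas : Measurable N) (hNpos : ∀ ω, 1 ≤ N ω)
    (hN_indep : IndepFun N
      (fun ω => (fun i : ℕ => X i ω, fun q : ℕ × ℕ => a q.1 q.2 ω)) P)
    (hNmom : ∃ ε : ℝ, 0 < ε ∧
      ∫⁻ ω, ENNReal.ofReal ((N ω : ℝ) ^ ((2 : ℝ) + α + ε)) ∂P < ⊤)
    (nn : (ℕ → ℝ) → ℝ)
    (hnn_tri : ∀ u v : ℕ → ℝ, (Function.support u).Finite → (Function.support v).Finite →
      nn (u + v) ≤ nn u + nn v)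
    (hnn_smul : ∀ (c : ℝ) (u : ℕ → ℝ), (Function.support u).Finite →
      nn (c • u) = |c| * nn u)
    (hnn_zero : ∀ u : ℕ → ℝ, (Function.support u).Finite → nn u = 0 → u = 0)
    (hnn_lower : ∀ u : ℕ → ℝ, (Function.support u).Finite → ∀ i, |u i| ≤ nn u)
    (hnn_upper : ∀ u : ℕ → ℝ, (Function.support u).Finite → nn u ≤ ∑' i, |u i|)
    (hAmom : ∃ ε : ℝ, 0 < ε ∧
      ∫⁻ ω, ENNReal.ofReal (seqOpNorm nn (fun i j => a i j ω) (N ω) ^ (α + ε)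
        * (N ω : ℝ) ^ ((1 : ℝ) + α + ε)) ∂P < ⊤) :
    Tendsto (fun n₀ : ℕ =>
        ⨆ x : {x : ℝ // 0 < x},
          ∑' n : {m : ℕ // n₀ < m},
            (P {ω | N ω = (n : ℕ)}).toReal *
              ((P {ω | (x : ℝ) < nn (matVecSeq (fun i j => a i j ω) (n : ℕ)
                  (fun i => X (i + 1) ω))}).toReal
                / (P {ω | (x : ℝ) < X 1 ω}).toReal))
      atTop (nhds 0) := by
  classical
  obtain ⟨ε, hε, hA⟩ := hAmom
  obtain ⟨ε', hε', hN⟩ := hNmom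
  set β := α + ε with hβ
  have hβ0 : 0 < β := by linarith
  obtain ⟨C, hC, hpot⟩ := potter (fun x => (P {ω | x < X 1 ω}).toReal)
    (fun x y hxy => ENNReal.toReal_mono (measure_ne_top _ _)
      (measure_mono fun ω hω => lt_of_le_of_lt hxy hω))
    (fun x => by
      have := ENNReal.toReal_mono ENNReal.one_ne_top (prob_le_one (μ := P) (s := {ω | x < X 1 ω}))
      simpa using this)
    (fun x hx => ENNReal.toReal_pos (hRVpos x hx).ne' (measure_ne_top _ _))
    α β hβ0 (by linarith) (hRV 2 (by norm_num))
  obtain ⟨O, hO⟩ : ∃ O : ℕ → (ℕ × ℕ → ℝ) → ℝ,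
      ∀ n A, O n A = seqOpNorm nn (fun i j => A (i, j)) n := ⟨_, fun _ _ => rfl⟩
  obtain ⟨am, hamd⟩ : ∃ am : Ω → ℕ × ℕ → ℝ, am = fun ω q => a q.1 q.2 ω := ⟨_, rfl⟩
  have ham : Measurable am := by
    rw [hamd]
    exact measurable_pi_lambda _ fun q => hameas q.1 q.2
  have hOm : ∀ n, Measurable (O n) := by
    intro n
    have h := op_meas nn hnn_tri hnn_smul hnn_lower hnn_upper n
    have e : O n = fun A : ℕ × ℕ → ℝ => seqOpNorm nn (fun i j => A (i, j)) n := funext (hO n)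
    rw [e]; exact h
  have hop : ∀ n ω, O n (am ω) = seqOpNorm nn (fun i j => a i j ω) n := by
    intro n ω
    rw [hO, hamd]
  have hop0 : ∀ n ω, 0 ≤ O n (am ω) := by
    intro n ω
    rw [hop]
    exact op_nonneg nn hnn_lower _ n
  have haX : IndepFun am (fun ω => fun i : ℕ => X i ω) P := by
    rw [hamd]; exact haX_indep
  have hNi : IndepFun N (fun ω => (fun i : ℕ => X i ω, am ω)) P := by
    rw [hamd]; exact hN_indep
  -- fixed scalar bound
  have hscal : ∀ x : ℝ, 0 < x → ∀ i, 1 ≤ i → ∀ s : ℝ, 0 ≤ s →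
      P {ω | x < s * X i ω} ≤ ENNReal.ofReal (C * (1 + s ^ β)) * P {ω | x < X 1 ω} := by
    intro x hx i hi s hs
    exact scal_bound P (X 1) (X i) (hXid i hi) C β hC x hx (hpot x hx) s hs
  obtain ⟨Φ, hΦ⟩ : ∃ Φ : ℕ → (ℕ × ℕ → ℝ) → ENNReal,
      ∀ n A, Φ n A = ENNReal.ofReal (C * (1 + (n * O n A) ^ β)) := ⟨_, fun _ _ => rfl⟩
  have hΦm : ∀ n : ℕ, Measurable (Φ n) := by
    intro n
    have e : Φ n = fun A => ENNReal.ofReal (C * (1 + (n * O n A) ^ β)) := funext (hΦ n)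
    have := hOm n
    rw [e]
    fun_prop
  have hFmeas : ∀ n, Measurable fun ω => Φ n (am ω) := fun n => (hΦm n).comp ham
  have hone : ∀ x : ℝ, 0 < x → ∀ n i : ℕ, 1 ≤ i →
      P {ω | x < n * O n (am ω) * X i ω} ≤ (∫⁻ ω, Φ n (am ω) ∂P) * P {ω | x < X 1 ω} := by
    intro x hx n i hi
    rw [← lintegral_mul_const _ (hFmeas n)]
    have hin : IndepFun (fun ω => n * O n (am ω)) (X i) P :=
      haX.comp (φ := fun A : ℕ × ℕ → ℝ => n * O n A)
        (ψ := fun u : ℕ → ℝ => u i) ((hOm n).const_mul _) (measurable_pi_apply i)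
    have h := tail_indep P (fun ω => n * O n (am ω)) (X i) (((hOm n).comp ham).const_mul _)
      (hXmeas i) (fun ω => mul_nonneg (Nat.cast_nonneg _) (hop0 n ω)) hin x
      (fun s => ENNReal.ofReal (C * (1 + s ^ β)) * P {ω | x < X 1 ω}) (hscal x hx i hi)
    simp only [hΦ]
    exact h
  have hunion : ∀ x : ℝ, 0 < x → ∀ n : ℕ, 1 ≤ n →
      P {ω | x < nn (matVecSeq (fun i j => a i j ω) n (fun i => X (i + 1) ω))} ≤
        n * ((∫⁻ ω, Φ n (am ω) ∂P) * P {ω | x < X 1 ω}) := by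
    intro x hx n hn
    have hsub : {ω | x < nn (matVecSeq (fun i j => a i j ω) n (fun i => X (i + 1) ω))} ⊆
        ⋃ j ∈ Finset.range n, {ω | x < n * O n (am ω) * X (j + 1) ω} := by
      intro ω hω
      by_contra hcon
      simp only [Set.mem_iUnion, Set.mem_ofPred_eq, not_exists, not_lt] at hcon
      have h1 := mv_le_sum nn hnn_smul hnn_zero hnn_lower hnn_upper (fun i j => a i j ω) n
        (fun i => X (i + 1) ω)
      rw [← hop] at h1
      have h2 : (n : ℝ) * (O n (am ω) * ∑ i ∈ Finset.range n, |X (i + 1) ω|) ≤ n * x := by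
        rw [Finset.mul_sum, Finset.mul_sum]
        refine (Finset.sum_le_card_nsmul _ _ x ?_).trans (by simp)
        intro i hi
        rw [abs_of_nonneg (hXnonneg _ _), ← mul_assoc]
        exact hcon i hi
      have h3 := le_of_mul_le_mul_left h2 (by exact_mod_cast hn)
      exact absurd (lt_of_lt_of_le hω (h1.trans h3)) (lt_irrefl _)
    refine (measure_mono hsub).trans ((measure_biUnion_finset_le _ _).trans ?_)
    refine (Finset.sum_le_card_nsmul _ _ _ (fun j _ => hone x hx n (j + 1) (by omega))).trans ?_
    simp
  let I : ℕ → Ω → ENNReal := fun n ω => if N ω = n then 1 else 0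
  have hImeas : ∀ n, Measurable (I n) := fun n =>
    Measurable.ite (hNmeas (measurableSet_singleton n)) measurable_const measurable_const
  let G : ℕ → ENNReal := fun n => ∫⁻ ω, n * (I n ω * Φ n (am ω)) ∂P
  have hprod : ∀ n, P {ω | N ω = n} * ∫⁻ ω, Φ n (am ω) ∂P = ∫⁻ ω, I n ω * Φ n (am ω) ∂P := by
    intro n
    have hind : IndepFun (I n) (fun ω => Φ n (am ω)) P :=
      hNi.comp (φ := fun m : ℕ => if m = n then (1 : ENNReal) else 0)
        (ψ := fun p : (ℕ → ℝ) × (ℕ × ℕ → ℝ) => Φ n p.2)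
        (measurable_of_countable _) ((hΦm n).comp measurable_snd)
    have := lintegral_mul_eq_lintegral_mul_lintegral_of_indepFun (hImeas n) (hFmeas n) hind
    simp only [Pi.mul_apply] at this
    rw [this]
    congr 1
    have hs : MeasurableSet {ω | N ω = n} := hNmeas (measurableSet_singleton n)
    rw [← lintegral_indicator_one hs]
    apply lintegral_congr
    intro ω
    simp [I, Set.indicator_apply]
  have hGsum : ∑' n, G n ≠ ⊤ := by
    have h1 : ∑' n, G n = ∫⁻ ω, ∑' n : ℕ, (n : ENNReal) * (I n ω * Φ n (am ω)) ∂P := by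
      rw [lintegral_tsum]
      intro n
      exact (((hImeas n).mul (hFmeas n)).const_mul _).aemeasurable
    have h2 : ∀ ω, ∑' n : ℕ, (n : ENNReal) * (I n ω * Φ n (am ω)) ≤
        ENNReal.ofReal C * (ENNReal.ofReal ((N ω : ℝ) ^ ((2 : ℝ) + α + ε')) +
          ENNReal.ofReal (seqOpNorm nn (fun i j => a i j ω) (N ω) ^ β
            * (N ω : ℝ) ^ ((1 : ℝ) + α + ε))) := by
      intro ω
      rw [tsum_eq_single (N ω) (by
        intro b hb
        simp [I, hb.symm])]
      have hN1 : (1 : ℝ) ≤ N ω := by exact_mod_cast hNpos ω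
      have hN0 : (0 : ℝ) < N ω := by linarith
      have ho := hop0 (N ω) ω
      simp only [I, if_true, one_mul]
      rw [hΦ, ← hop]
      rw [← ENNReal.ofReal_natCast, ← ENNReal.ofReal_mul hN0.le,
        ← ENNReal.ofReal_add (by positivity)
          (mul_nonneg (Real.rpow_nonneg ho _) (by positivity)), ← ENNReal.ofReal_mul hC.le]
      apply ENNReal.ofReal_le_ofReal
      have e1 : (N ω : ℝ) ≤ (N ω : ℝ) ^ ((2 : ℝ) + α + ε') := by
        conv_lhs => rw [← Real.rpow_one (N ω : ℝ)]
        exact Real.rpow_le_rpow_of_exponent_le hN1 (by linarith)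
      have e2 : (N ω : ℝ) ^ ((1 : ℝ) + α + ε) = N ω * (N ω : ℝ) ^ β := by
        rw [add_assoc, Real.rpow_add hN0, Real.rpow_one]
      rw [e2, Real.mul_rpow hN0.le ho]
      calc (N ω : ℝ) * (C * (1 + (N ω : ℝ) ^ β * O (N ω) (am ω) ^ β))
          = C * (N ω + O (N ω) (am ω) ^ β * (N ω * (N ω : ℝ) ^ β)) := by ring
        _ ≤ _ := by gcongr
    rw [h1]
    refine ne_top_of_le_ne_top ?_ (lintegral_mono h2)
    rw [lintegral_const_mul' _ _ ENNReal.ofReal_ne_top, lintegral_add_left (by fun_prop)]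
    exact ENNReal.mul_ne_top ENNReal.ofReal_ne_top (ENNReal.add_ne_top.2 ⟨hN.ne, hA.ne⟩)
  have hG : ∀ n, G n ≠ ⊤ := ENNReal.ne_top_of_tsum_ne_top hGsum
  have hgsum : Summable fun n => (G n).toReal := ENNReal.summable_toReal hGsum
  have hterm : ∀ x : ℝ, 0 < x → ∀ n : ℕ, 1 ≤ n → (P {ω | N ω = n}).toReal *
      ((P {ω | x < nn (matVecSeq (fun i j => a i j ω) n (fun i => X (i + 1) ω))}).toReal
        / (P {ω | x < X 1 ω}).toReal) ≤ (G n).toReal := by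
    intro x hx n hn
    have hT : 0 < (P {ω | x < X 1 ω}).toReal :=
      ENNReal.toReal_pos (hRVpos x hx).ne' (measure_ne_top _ _)
    rw [← mul_div_assoc, div_le_iff₀ hT, ← ENNReal.toReal_mul, ← ENNReal.toReal_mul]
    apply ENNReal.toReal_mono (ENNReal.mul_ne_top (hG n) (measure_ne_top _ _))
    refine (mul_le_mul_right (hunion x hx n hn) _).trans (le_of_eq ?_)
    simp only [G]
    rw [lintegral_const_mul' _ _ (ENNReal.natCast_ne_top n), ← hprod n]
    ring
  have hlim : Tendsto (fun n₀ : ℕ => ∑' n : {m : ℕ // n₀ < m}, (G n).toReal) atTop (nhds 0) := by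
    have h1 := tendsto_tsum_compl_atTop_zero fun n => (G n).toReal
    have h2 : Tendsto (fun n₀ : ℕ => Finset.range (n₀ + 1)) atTop atTop :=
      tendsto_finset_range.comp (tendsto_add_atTop_nat 1)
    refine (h1.comp h2).congr ?_
    intro n₀
    refine (Equiv.subtypeEquivRight fun m => ?_).tsum_eq
      (fun n : {m : ℕ // n₀ < m} => (G n).toReal)
    simp
  refine squeeze_zero (fun n₀ => ?_) (fun n₀ => ?_) hlim
  · exact Real.iSup_nonneg fun x => tsum_nonneg fun n => by positivity
  · have : Nonempty {x : ℝ // 0 < x} := ⟨⟨1, one_pos⟩⟩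
    apply ciSup_le
    intro x
    have hs : Summable fun n : {m : ℕ // n₀ < m} => (G n).toReal :=
      hgsum.comp_injective Subtype.val_injective
    have hle := fun n : {m : ℕ // n₀ < m} => hterm x x.2 n (by have := n.2; omega)
    exact (Summable.of_nonneg_of_le (fun n => by positivity) hle hs).tsum_le_tsum hle hs
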